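/- arXiv:0907.0876 — 6 statements merged into one kernel-verified Lean document; each statement's English description precedes it below -/
import Mathlib

section
/- Let R be a commutative ring with many units. The coinvariants group P(R) := H_0(GL_2(R), ∂_3(D_3(R²))) is isomorphic to the abelian group presented as follows: generators are symbols [a1,a2;λ1,λ2] with a1, a2, λ1, λ2, 1−λ1, 1−λ2, λ1−λ2 ∈ R^×, and relations are [(λ2−λ1)a2, λ1; (γ2−γ1)/(λ2−λ1), γ1/λ1] − [(λ1−λ2)a1, λ2; (γ1−γ2)/(λ1−λ2), γ2/λ2] + [λ1a1, λ2a2; γ1/λ1, γ2/λ2] − [a1,a2; γ1,γ2] + [a1,a2; λ1,λ2] = 0 for all λ1, λ2, γ1, γ2 with λi, 1−λi, γi, 1−γi, λ1−λ2, γ1−γ2, λi−γj ∈ R^× (i,j ∈ {1,2}). -/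
/-- `R²` as column vectors. -/
abbrev V2 (R : Type) [CommRing R] : Type := Fin 2 → R

/-- `(l+1)`-tuples of vectors of `R²`. -/
abbrev Tup (R : Type) [CommRing R] (l : ℕ) : Type := Fin (l + 1) → V2 R

/-- A family of vectors of `R²` is a basis of a direct summand of `R²` if it is linearly
independent and its span admits a complement. -/
def IsBDS (R : Type) [CommRing R] {k : ℕ} (v : Fin k → V2 R) : Prop :=
  LinearIndependent R v ∧
  ∃ N : Submodule R (V2 R), IsCompl (Submodule.span R (Set.range v)) N

/-- An `(l+1)`-tuple is a frame (a basis element of `D_l(R²)`) if every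
`min (l+1) 2` of its members form a basis of a direct summand of `R²`. -/
def IsFrame (R : Type) [CommRing R] {l : ℕ} (v : Tup R l) : Prop :=
  ∀ ι : Fin (min (l + 1) 2) → Fin (l + 1), Function.Injective ι → IsBDS R (v ∘ ι)

/-- The free `ℤ`-module on all `(l+1)`-tuples of vectors of `R²`. -/
abbrev EE (R : Type) [CommRing R] (l : ℕ) : Type := Tup R l →₀ ℤ

/-- `D_l(R²)`, the free `ℤ`-module on frames, as a subgroup of `EE R l`. -/
noncomputable def DD (R : Type) [CommRing R] (l : ℕ) : AddSubgroup (EE R l) :=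
  (Finsupp.supported ℤ ℤ {v : Tup R l | IsFrame R v}).toAddSubgroup

/-- The simplicial boundary `∂ : E_{l+1} → E_l`, the alternating sum of the face maps
deleting one entry of a tuple.  Its restriction to `D_{l+1}(R²)` is the differential
`∂_{l+1} : D_{l+1}(R²) → D_l(R²)`. -/
noncomputable def bdE (R : Type) [CommRing R] (l : ℕ) : EE R (l + 1) →+ EE R l :=
  Finsupp.liftAddHom fun v =>
    ∑ i : Fin (l + 2), ((-1 : ℤ) ^ (i : ℕ)) • Finsupp.singleAddHom (v ∘ i.succAbove)

/-- The diagonal action of `GL₂(R)` on tuples of vectors. -/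
def gT (R : Type) [CommRing R] {l : ℕ} (g : GL (Fin 2) R) (v : Tup R l) : Tup R l :=
  fun i => (g : Matrix (Fin 2) (Fin 2) R).mulVec (v i)

/-- The subgroup of `EE R l` generated by the elements `g • y - y` with `y ∈ S`;
for a `GL₂(R)`-stable subgroup `S` the quotient `S/(this ∩ S)` is the group of
coinvariants `H₀(GL₂(R), S)`. -/
noncomputable def coinvOf (R : Type) [CommRing R] (l : ℕ) (S : AddSubgroup (EE R l)) :
    AddSubgroup (EE R l) :=
  AddSubgroup.closure
    {x | ∃ (g : GL (Fin 2) R) (y : EE R l), y ∈ S ∧ x = Finsupp.mapDomain (gT R g) y - y}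

/-- `H₀(GL₂(R), S)`, the coinvariants of a (`GL₂(R)`-stable) subgroup `S ≤ EE R l`. -/
abbrev H0 (R : Type) [CommRing R] (l : ℕ) (S : AddSubgroup (EE R l)) : Type :=
  S ⧸ ((coinvOf R l S).addSubgroupOf S)
/-- A commutative ring has *many units* if for every `n ≥ 2` and every finite family of
surjective linear forms `f i : R^n → R` there is a vector `v` with all `f i v` units. -/
def ManyUnits (R : Type) [CommRing R] : Prop :=
  ∀ n : ℕ, 2 ≤ n → ∀ (k : ℕ) (f : Fin k → ((Fin n → R) →ₗ[R] R)),
    (∀ i, Function.Surjective (f i)) → ∃ v : Fin n → R, ∀ i, IsUnit (f i v)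
/-- Index set for the generators of the presented group `𝒫(R)`: quadruples
`(a₁, a₂, λ₁, λ₂)` with `a₁, a₂, λ₁, λ₂, 1-λ₁, 1-λ₂, λ₁-λ₂` units. -/
abbrev PIdx (R : Type) [CommRing R] : Type :=
  {q : R × R × R × R // IsUnit q.1 ∧ IsUnit q.2.1 ∧ IsUnit q.2.2.1 ∧ IsUnit q.2.2.2 ∧
    IsUnit (1 - q.2.2.1) ∧ IsUnit (1 - q.2.2.2) ∧ IsUnit (q.2.2.1 - q.2.2.2)}

/-- The subgroup of relations of `𝒫(R)`. -/
noncomputable def PRel (R : Type) [CommRing R] : AddSubgroup (PIdx R →₀ ℤ) :=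
  AddSubgroup.closure
    {x | ∃ a1 a2 l1 l2 g1 g2 : R, ∃ q1 q2 q3 q4 q5 : PIdx R,
      IsUnit a1 ∧ IsUnit a2 ∧ IsUnit l1 ∧ IsUnit l2 ∧ IsUnit g1 ∧ IsUnit g2 ∧
      IsUnit (1 - l1) ∧ IsUnit (1 - l2) ∧ IsUnit (1 - g1) ∧ IsUnit (1 - g2) ∧
      IsUnit (l1 - l2) ∧ IsUnit (g1 - g2) ∧
      IsUnit (l1 - g1) ∧ IsUnit (l1 - g2) ∧ IsUnit (l2 - g1) ∧ IsUnit (l2 - g2) ∧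
      (q1 : R × R × R × R)
        = ((l2 - l1) * a2, l1, (g2 - g1) * Ring.inverse (l2 - l1), g1 * Ring.inverse l1) ∧
      (q2 : R × R × R × R)
        = ((l1 - l2) * a1, l2, (g1 - g2) * Ring.inverse (l1 - l2), g2 * Ring.inverse l2) ∧
      (q3 : R × R × R × R)
        = (l1 * a1, l2 * a2, g1 * Ring.inverse l1, g2 * Ring.inverse l2) ∧
      (q4 : R × R × R × R) = (a1, a2, g1, g2) ∧
      (q5 : R × R × R × R) = (a1, a2, l1, l2) ∧
      x = Finsupp.single q1 1 - Finsupp.single q2 1 + Finsupp.single q3 1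
          - Finsupp.single q4 1 + Finsupp.single q5 1}

/-- The group `𝒫(R)` presented by generators `[a₁,a₂;λ₁,λ₂]` and the relations above. -/
abbrev PPres (R : Type) [CommRing R] : Type := (PIdx R →₀ ℤ) ⧸ PRel R

/-- The determinant of a pair of vectors of `R²`. -/
def det2 {R : Type} [CommRing R] (u w : V2 R) : R := u 0 * w 1 - u 1 * w 0

section PairDeterminants

variable {R : Type} [CommRing R]

theorem V2.ext_iff' {u w : V2 R} : u = w ↔ u 0 = w 0 ∧ u 1 = w 1 := by
  rw [funext_iff, Fin.forall_fin_two]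

theorem det2_self (u : V2 R) : det2 u u = 0 := by
  simp only [det2]; ring

theorem det2_swap (u w : V2 R) : det2 w u = -det2 u w := by
  simp only [det2]; ring

theorem det2_sub_right (u w x : V2 R) : det2 u (w - x) = det2 u w - det2 u x := by
  simp only [det2, Pi.sub_apply]; ring

theorem det2_smul_add_smul (u w : V2 R) (a b a' b' : R) :
    det2 (a • u + b • w) (a' • u + b' • w) = (a * b' - b * a') * det2 u w := by
  simp only [det2, Pi.add_apply, Pi.smul_apply, smul_eq_mul]; ring

theorem cramer2 {u w : V2 R} {y : R} (hy : det2 u w * y = 1) (x : V2 R) :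
    x = (-det2 w x * y) • u + (det2 u x * y) • w := by
  rw [V2.ext_iff']
  simp only [det2, Pi.add_apply, Pi.smul_apply, smul_eq_mul] at *
  constructor
  · linear_combination (-x 0) * hy
  · linear_combination (-x 1) * hy

theorem smul_add_smul_inj {u w : V2 R} (h : IsUnit (det2 u w)) {a b a' b' : R}
    (e : a • u + b • w = a' • u + b' • w) : a = a' ∧ b = b' := by
  obtain ⟨e0, e1⟩ := V2.ext_iff'.1 e
  simp only [Pi.add_apply, Pi.smul_apply, smul_eq_mul] at e0 e1
  constructor
  · apply h.mul_left_cancel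
    simp only [det2]
    linear_combination w 1 * e0 - w 0 * e1
  · apply h.mul_left_cancel
    simp only [det2]
    linear_combination u 0 * e1 - u 1 * e0

theorem isBDS_pair_iff {v : Fin 2 → V2 R} : IsBDS R v ↔ IsUnit (det2 (v 0) (v 1)) := by
  constructor
  · rintro ⟨hli, N, hN⟩
    let f : (Fin 2 → R) →ₗ[R] V2 R := Fintype.linearCombination R v
    have hf : Function.Injective f := hli.fintypeLinearCombination_injective
    have hr : LinearMap.range f = Submodule.span R (Set.range v) :=
      Fintype.range_linearCombination R v
    rw [← hr] at hN
    let e := LinearEquiv.ofInjective f hf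
    let p := Submodule.projectionOnto _ _ hN
    have hp : Function.Surjective p := by
      intro y
      exact ⟨y, Submodule.projectionOnto_apply_left hN y⟩
    have hg : Function.Injective (e.symm.toLinearMap ∘ₗ p) :=
      OrzechProperty.injective_of_surjective_endomorphism _ (e.symm.surjective.comp hp)
    have hpi : Function.Injective p := fun a b hab => hg (by simp [hab])
    have htop : Function.Surjective f := by
      intro x
      have hx : ((p x : LinearMap.range f) : V2 R) = x :=
        hpi (Submodule.projectionOnto_apply_left hN (p x))
      rw [← hx]
      exact (p x).2
    obtain ⟨c, hc⟩ := htop ![1, 0]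
    obtain ⟨c', hc'⟩ := htop ![0, 1]
    have key : (c 0 * c' 1 - c 1 * c' 0) * det2 (v 0) (v 1) = 1 := by
      rw [← det2_smul_add_smul]
      simp only [f, Fintype.linearCombination_apply, Fin.sum_univ_two] at hc hc'
      rw [hc, hc']
      simp [det2]
    exact IsUnit.of_mul_eq_one_right _ key
  · intro h
    constructor
    · rw [Fintype.linearIndependent_iff]
      intro c hc
      rw [Fin.sum_univ_two] at hc
      have h0 := smul_add_smul_inj h (hc.trans (by simp) : _ = (0 : R) • v 0 + (0 : R) • v 1)
      exact Fin.forall_fin_two.2 h0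
    · refine ⟨⊥, ?_⟩
      have : Submodule.span R (Set.range v) = ⊤ := by
        obtain ⟨y, hy⟩ := h.exists_right_inv
        rw [eq_top_iff]
        intro x _
        rw [cramer2 hy x]
        exact add_mem (Submodule.smul_mem _ _ (Submodule.subset_span ⟨0, rfl⟩))
          (Submodule.smul_mem _ _ (Submodule.subset_span ⟨1, rfl⟩))
      rw [this]
      exact isCompl_top_bot

theorem isFrame_three_iff {v : Tup R 3} :
    IsFrame R v ↔ ∀ i j, i ≠ j → IsUnit (det2 (v i) (v j)) := by
  constructor
  · intro h i j hij
    have := isBDS_pair_iff.1 (h ![i, j] (by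
      intro a b hab
      change Fin 2 at a b
      fin_cases a <;> fin_cases b <;> simp_all [eq_comm]))
    simpa using this
  · intro h ι hι
    exact isBDS_pair_iff.2 (h _ _ (fun e => absurd (hι e) (by decide)))

theorem isFrame_vec_iff {v0 v1 v2 v3 : V2 R} :
    IsFrame R (l := 3) ![v0, v1, v2, v3] ↔
      IsUnit (det2 v0 v1) ∧ IsUnit (det2 v0 v2) ∧ IsUnit (det2 v0 v3) ∧
      IsUnit (det2 v1 v2) ∧ IsUnit (det2 v1 v3) ∧ IsUnit (det2 v2 v3) := by
  have hs : ∀ u w : V2 R, IsUnit (det2 u w) → IsUnit (det2 w u) := by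
    intro u w h
    rw [det2_swap]
    exact h.neg
  rw [isFrame_three_iff]
  constructor
  · intro h
    exact ⟨h 0 1 (by decide), h 0 2 (by decide), h 0 3 (by decide), h 1 2 (by decide),
      h 1 3 (by decide), h 2 3 (by decide)⟩
  · rintro ⟨h01, h02, h03, h12, h13, h23⟩ i j hij
    fin_cases i <;> fin_cases j <;> first
      | exact absurd rfl hij
      | assumption
      | (apply hs; assumption)

/-- Over a ring with many units, finitely many affine conditions with unimodular linear part
can be made units simultaneously. -/
theorem ManyUnits.exists_isUnit_affine (hR : ManyUnits R) {ι : Type*} [Finite ι]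
    (u : ι → V2 R) (c : ι → R) (hu : ∀ i, ∃ x, IsUnit (det2 (u i) x)) :
    ∃ w : V2 R, ∀ i, IsUnit (det2 (u i) w - c i) := by
  obtain ⟨k, ⟨e⟩⟩ := Finite.exists_equiv_fin (Option ι)
  let p (i : Fin 3) : (Fin 3 → R) →ₗ[R] R := LinearMap.proj i
  let F : Option ι → ((Fin 3 → R) →ₗ[R] R) := fun o =>
    o.elim (p 2) fun i => u i 0 • p 1 - u i 1 • p 0 - c i • p 2
  have hF : ∀ o, Function.Surjective (F o) := by
    rintro (_ | i) r
    · exact ⟨![0, 0, r], by simp [F, p]⟩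
    · obtain ⟨x, hx⟩ := hu i
      obtain ⟨y, hy⟩ := hx.exists_right_inv
      refine ⟨![x 0 * (y * r), x 1 * (y * r), 0], ?_⟩
      simp only [det2] at hy
      simp [F, p]
      linear_combination r * hy
  obtain ⟨s, hs⟩ := hR 3 (by norm_num) k (fun j => F (e.symm j)) (fun j => hF _)
  have hs' : ∀ o, IsUnit (F o s) := fun o => by simpa using hs (e o)
  have h2 : IsUnit (s 2) := by simpa [F, p] using hs' none
  obtain ⟨y, hy⟩ := h2.exists_right_inv
  refine ⟨![s 0 * y, s 1 * y], fun i => ?_⟩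
  have hi := (hs' (some i)).mul (IsUnit.of_mul_eq_one_right _ hy)
  convert hi using 1
  simp [F, p, det2]
  linear_combination (c i) * hy

end PairDeterminants

section Coordinates

variable {R : Type} [CommRing R]

/-- The quadruple of vectors `v` is in the orbit of `(e₁, e₂, a, λa)`, where
`q = (a₁, a₂, λ₁, λ₂)`. -/
def HasCoord (v : Tup R 3) (q : PIdx R) : Prop :=
  IsUnit (det2 (v 0) (v 1)) ∧ v 2 = q.1.1 • v 0 + q.1.2.1 • v 1 ∧
    v 3 = (q.1.2.2.1 * q.1.1) • v 0 + (q.1.2.2.2 * q.1.2.1) • v 1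

theorem HasCoord.eq_of_smul {v : Tup R 3} {q : PIdx R} (h : HasCoord v q) {a1 a2 l1 l2 : R}
    (h2 : v 2 = a1 • v 0 + a2 • v 1) (h3 : v 3 = (l1 * a1) • v 0 + (l2 * a2) • v 1) :
    (q : R × R × R × R) = (a1, a2, l1, l2) := by
  obtain ⟨⟨b1, b2, m1, m2⟩, hb1, hb2, hm⟩ := q
  obtain ⟨hd, e2, e3⟩ := h
  obtain ⟨rfl, rfl⟩ := smul_add_smul_inj hd (e2.symm.trans h2)
  obtain ⟨i1, i2⟩ := smul_add_smul_inj hd (e3.symm.trans h3)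
  exact congrArg₂ (fun x y => (b1, b2, x, y)) (hb1.mul_right_cancel i1) (hb2.mul_right_cancel i2)

theorem HasCoord.unique {v : Tup R 3} {q q' : PIdx R} (h : HasCoord v q) (h' : HasCoord v q') :
    q = q' :=
  Subtype.ext (h.eq_of_smul h'.2.1 h'.2.2)

theorem HasCoord.isFrame {v : Tup R 3} {q : PIdx R} (h : HasCoord v q) : IsFrame R v := by
  obtain ⟨⟨a1, a2, l1, l2⟩, ha1, ha2, hl1, hl2, hl1', hl2', hl⟩ := q
  obtain ⟨hd, e2, e3⟩ := h
  have hv : v = ![v 0, v 1, v 2, v 3] := by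
    ext i; fin_cases i <;> rfl
  rw [hv, isFrame_vec_iff]
  simp only at *
  generalize v 0 = v0 at *
  generalize v 1 = v1 at *
  generalize v 2 = v2 at *
  generalize v 3 = v3 at *
  subst e2 e3
  refine ⟨hd, ?_, ?_, ?_, ?_, ?_⟩
  · convert ha2.mul hd using 1
    simp only [det2, Pi.add_apply, Pi.smul_apply, smul_eq_mul]; ring
  · convert (hl2.mul ha2).mul hd using 1
    simp only [det2, Pi.add_apply, Pi.smul_apply, smul_eq_mul]; ring
  · convert (ha1.mul hd).neg using 1
    simp only [det2, Pi.add_apply, Pi.smul_apply, smul_eq_mul]; ring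
  · convert ((hl1.mul ha1).mul hd).neg using 1
    simp only [det2, Pi.add_apply, Pi.smul_apply, smul_eq_mul]; ring
  · convert (((ha1.mul ha2).mul hl).mul hd).neg using 1
    simp only [det2, Pi.add_apply, Pi.smul_apply, smul_eq_mul]; ring

theorem exists_hasCoord {v0 v1 v2 v3 : V2 R} (h01 : IsUnit (det2 v0 v1))
    (h02 : IsUnit (det2 v0 v2)) (h03 : IsUnit (det2 v0 v3)) (h12 : IsUnit (det2 v1 v2))
    (h13 : IsUnit (det2 v1 v3)) (h23 : IsUnit (det2 v2 v3))
    (h0 : IsUnit (det2 v0 (v3 - v2))) (h1 : IsUnit (det2 v1 (v3 - v2))) :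
    ∃ q : PIdx R, HasCoord ![v0, v1, v2, v3] q := by
  obtain ⟨y, hy⟩ := h01.exists_right_inv
  obtain ⟨y02, hy02⟩ := h02.exists_right_inv
  obtain ⟨y12, hy12⟩ := h12.exists_right_inv
  have uy := IsUnit.of_mul_eq_one_right _ hy
  have uy02 := IsUnit.of_mul_eq_one_right _ hy02
  have uy12 := IsUnit.of_mul_eq_one_right _ hy12
  rw [det2_sub_right] at h0 h1
  have pl : det2 v0 v1 * det2 v2 v3 = det2 v0 v2 * det2 v1 v3 - det2 v0 v3 * det2 v1 v2 := by
    simp only [det2]; ring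
  refine ⟨⟨(-det2 v1 v2 * y, det2 v0 v2 * y, det2 v1 v3 * y12, det2 v0 v3 * y02),
    h12.neg.mul uy, h02.mul uy, h13.mul uy12, h03.mul uy02, ?_, ?_, ?_⟩, h01, cramer2 hy v2, ?_⟩
  · convert (h1.mul uy12).neg using 1
    linear_combination -hy12
  · convert (h0.mul uy02).neg using 1
    linear_combination -hy02
  · convert ((h01.mul h23).mul uy12).mul uy02 using 1
    rw [pl]
    linear_combination (-det2 v1 v3 * y12) * hy02 + det2 v0 v3 * y02 * hy12
  · change v3 = (det2 v1 v3 * y12 * (-det2 v1 v2 * y)) • v0 +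
      (det2 v0 v3 * y02 * (det2 v0 v2 * y)) • v1
    have e1 : det2 v1 v3 * y12 * (-det2 v1 v2 * y) = -det2 v1 v3 * y := by
      linear_combination (-det2 v1 v3 * y) * hy12
    have e2 : det2 v0 v3 * y02 * (det2 v0 v2 * y) = det2 v0 v3 * y := by
      linear_combination (det2 v0 v3 * y) * hy02
    rw [e1, e2]
    exact cramer2 hy v3

theorem hasCoord_vec_iff {v0 v1 v2 v3 : V2 R} {q : PIdx R} :
    HasCoord ![v0, v1, v2, v3] q ↔ IsUnit (det2 v0 v1) ∧ v2 = q.1.1 • v0 + q.1.2.1 • v1 ∧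
      v3 = (q.1.2.2.1 * q.1.1) • v0 + (q.1.2.2.2 * q.1.2.1) • v1 :=
  Iff.rfl

/-- The vector `w` is in general position with respect to the members of `v`. -/
def Generic (v : Tup R 3) (w : V2 R) : Prop :=
  ∀ j k, IsUnit (det2 (v j) (w - v k))

theorem Generic.isUnit_det2 {v : Tup R 3} {w : V2 R} (h : Generic v w) (j : Fin 4) :
    IsUnit (det2 (v j) w) := by
  have := h j j
  rwa [det2_sub_right, det2_self, sub_zero] at this

theorem ManyUnits.exists_generic (hR : ManyUnits R) {ι : Type*} [Finite ι] (v : ι → Tup R 3)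
    (hv : ∀ i, IsFrame R (v i)) (p r : ι → R) :
    ∃ w : V2 R, ∀ i, Generic (v i) w ∧ IsUnit (det2 (v i 0) w - p i) ∧
      IsUnit (det2 (v i 1) w - r i) := by
  obtain ⟨w, hw⟩ := hR.exists_isUnit_affine (ι := ι × Fin 4 × Fin 6)
    (fun x => v x.1 x.2.1)
    (fun x => ![det2 (v x.1 x.2.1) (v x.1 0), det2 (v x.1 x.2.1) (v x.1 1),
      det2 (v x.1 x.2.1) (v x.1 2), det2 (v x.1 x.2.1) (v x.1 3), p x.1, r x.1] x.2.2)
    (fun x => ⟨v x.1 (x.2.1 + 1), isFrame_three_iff.1 (hv x.1) _ _ (by simp)⟩)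
  refine ⟨w, fun i => ⟨fun j k => ?_, hw (i, 0, 4), hw (i, 1, 5)⟩⟩
  rw [det2_sub_right]
  fin_cases k
  · exact hw (i, j, 0)
  · exact hw (i, j, 1)
  · exact hw (i, j, 2)
  · exact hw (i, j, 3)

theorem Generic.exists_hasCoord_faces {v0 v1 v2 v3 w : V2 R} (h : Generic ![v0, v1, v2, v3] w)
    (hv : IsFrame R (l := 3) ![v0, v1, v2, v3]) :
    ∃ q1 q2 q3 q4 : PIdx R, HasCoord ![v1, v2, v3, w] q1 ∧ HasCoord ![v0, v2, v3, w] q2 ∧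
      HasCoord ![v0, v1, v3, w] q3 ∧ HasCoord ![v0, v1, v2, w] q4 := by
  obtain ⟨h01, h02, h03, h12, h13, h23⟩ := isFrame_vec_iff.1 hv
  have d0 : IsUnit (det2 v0 w) := h.isUnit_det2 0
  have d1 : IsUnit (det2 v1 w) := h.isUnit_det2 1
  have d2 : IsUnit (det2 v2 w) := h.isUnit_det2 2
  have d3 : IsUnit (det2 v3 w) := h.isUnit_det2 3
  obtain ⟨q1, hq1⟩ := exists_hasCoord h12 h13 d1 h23 d2 d3 (h 1 3) (h 2 3)
  obtain ⟨q2, hq2⟩ := exists_hasCoord h02 h03 d0 h23 d2 d3 (h 0 3) (h 2 3)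
  obtain ⟨q3, hq3⟩ := exists_hasCoord h01 h03 d0 h13 d1 d3 (h 0 3) (h 1 3)
  obtain ⟨q4, hq4⟩ := exists_hasCoord h01 h02 d0 h12 d1 d2 (h 0 2) (h 1 2)
  exact ⟨q1, q2, q3, q4, hq1, hq2, hq3, hq4⟩

/-- The coordinates of the faces of `(v₀, v₁, a, λa, γa)`. -/
theorem face_smul_eqs {v0 v1 v2 v3 w : V2 R} {a1 a2 l1 l2 g1 g2 : R}
    (hl1 : IsUnit l1) (hl2 : IsUnit l2) (hl : IsUnit (l1 - l2))
    (e2 : v2 = a1 • v0 + a2 • v1) (e3 : v3 = (l1 * a1) • v0 + (l2 * a2) • v1)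
    (ew : w = (g1 * a1) • v0 + (g2 * a2) • v1) :
    (v3 = ((l2 - l1) * a2) • v1 + l1 • v2 ∧
      w = ((g2 - g1) * Ring.inverse (l2 - l1) * ((l2 - l1) * a2)) • v1 +
        (g1 * Ring.inverse l1 * l1) • v2) ∧
    (v3 = ((l1 - l2) * a1) • v0 + l2 • v2 ∧
      w = ((g1 - g2) * Ring.inverse (l1 - l2) * ((l1 - l2) * a1)) • v0 +
        (g2 * Ring.inverse l2 * l2) • v2) ∧
    w = (g1 * Ring.inverse l1 * (l1 * a1)) • v0 + (g2 * Ring.inverse l2 * (l2 * a2)) • v1 := by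
  have hl' : IsUnit (l2 - l1) := by simpa using hl.neg
  have i1 := Ring.inverse_mul_cancel _ hl1
  have i2 := Ring.inverse_mul_cancel _ hl2
  have i3 := Ring.inverse_mul_cancel _ hl
  have i4 := Ring.inverse_mul_cancel _ hl'
  generalize Ring.inverse l1 = y1 at *
  generalize Ring.inverse l2 = y2 at *
  generalize Ring.inverse (l1 - l2) = y3 at *
  generalize Ring.inverse (l2 - l1) = y4 at *
  subst e2 e3 ew
  have c1 : g1 * y1 * l1 = g1 := by linear_combination g1 * i1
  have c2 : g2 * y2 * l2 = g2 := by linear_combination g2 * i2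
  have c3 : (g1 - g2) * y3 * ((l1 - l2) * a1) = (g1 - g2) * a1 := by
    linear_combination (g1 - g2) * a1 * i3
  have c4 : (g2 - g1) * y4 * ((l2 - l1) * a2) = (g2 - g1) * a2 := by
    linear_combination (g2 - g1) * a2 * i4
  rw [← mul_assoc (g1 * y1), ← mul_assoc (g2 * y2), c1, c2, c3, c4]
  refine ⟨⟨?_, ?_⟩, ⟨?_, ?_⟩, rfl⟩ <;> module

theorem relation_mem_PRel {v0 v1 v2 v3 w : V2 R} {q1 q2 q3 q4 q5 : PIdx R}
    (h1 : HasCoord ![v1, v2, v3, w] q1) (h2 : HasCoord ![v0, v2, v3, w] q2)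
    (h3 : HasCoord ![v0, v1, v3, w] q3) (h4 : HasCoord ![v0, v1, v2, w] q4)
    (h5 : HasCoord ![v0, v1, v2, v3] q5) (hw : Generic ![v0, v1, v2, v3] w)
    (hp : IsUnit (det2 v0 w - q5.1.2.2.1 * det2 v0 v2))
    (hr : IsUnit (det2 v1 w - q5.1.2.2.2 * det2 v1 v2)) :
    Finsupp.single q1 (1 : ℤ) - Finsupp.single q2 1 + Finsupp.single q3 1
      - Finsupp.single q4 1 + Finsupp.single q5 1 ∈ PRel R := by
  obtain ⟨⟨a1, a2, l1, l2⟩, ha1, ha2, hl1, hl2, hl1', hl2', hl⟩ := q5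
  obtain ⟨⟨b1, b2, g1, g2⟩, hb1, hb2, hg1, hg2, hg1', hg2', hg⟩ := q4
  obtain ⟨hd, e2, e3⟩ := hasCoord_vec_iff.1 h5
  obtain ⟨-, e2', ew⟩ := hasCoord_vec_iff.1 h4
  simp only at *
  obtain ⟨rfl, rfl⟩ := smul_add_smul_inj hd (e2.symm.trans e2')
  obtain ⟨⟨f1, f1'⟩, ⟨f2, f2'⟩, f3⟩ := face_smul_eqs hl1 hl2 hl e2 e3 ew
  have hw0 : IsUnit (det2 v0 (w - v3)) := hw 0 3
  have hw1 : IsUnit (det2 v1 (w - v3)) := hw 1 3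
  refine AddSubgroup.subset_closure ⟨a1, a2, l1, l2, g1, g2, q1, q2, q3, _, _, ha1, ha2, hl1, hl2,
    hg1, hg2, hl1', hl2', hg1', hg2', hl, hg, ?_, ?_, ?_, ?_, h1.eq_of_smul f1 f1',
    h2.eq_of_smul f2 f2', h3.eq_of_smul e3 f3, rfl, rfl, rfl⟩
  all_goals subst e2 e3 ew
  · refine isUnit_of_mul_isUnit_left (y := a1 * det2 v0 v1) ?_
    convert hw1 using 1
    simp only [det2, Pi.add_apply, Pi.sub_apply, Pi.smul_apply, smul_eq_mul]; ring
  · refine isUnit_of_mul_isUnit_left (y := -(a2 * det2 v0 v1)) ?_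
    convert hp using 1
    simp only [det2, Pi.add_apply, Pi.smul_apply, smul_eq_mul]; ring
  · refine isUnit_of_mul_isUnit_left (y := a1 * det2 v0 v1) ?_
    convert hr using 1
    simp only [det2, Pi.add_apply, Pi.smul_apply, smul_eq_mul]; ring
  · refine isUnit_of_mul_isUnit_left (y := -(a2 * det2 v0 v1)) ?_
    convert hw0 using 1
    simp only [det2, Pi.add_apply, Pi.sub_apply, Pi.smul_apply, smul_eq_mul]; ring

end Coordinates

section Boundary

variable {R : Type} [CommRing R]

theorem bdE_single {l : ℕ} (v : Tup R (l + 1)) (n : ℤ) :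
    bdE R l (Finsupp.single v n) =
      ∑ i : Fin (l + 2), ((-1 : ℤ) ^ (i : ℕ)) • Finsupp.single (v ∘ i.succAbove) n := by
  simp [bdE]

theorem bdE_two_vec (a b c e : V2 R) :
    bdE R 2 (Finsupp.single ![a, b, c, e] 1) = Finsupp.single ![b, c, e] 1
      - Finsupp.single ![a, c, e] 1 + Finsupp.single ![a, b, e] 1
      - Finsupp.single ![a, b, c] 1 := by
  have h0 : (![a, b, c, e] : Tup R 3) ∘ (0 : Fin 4).succAbove = ![b, c, e] := by
    funext i; fin_cases i <;> rfl
  have h1 : (![a, b, c, e] : Tup R 3) ∘ (1 : Fin 4).succAbove = ![a, c, e] := by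
    funext i; fin_cases i <;> rfl
  have h2 : (![a, b, c, e] : Tup R 3) ∘ (2 : Fin 4).succAbove = ![a, b, e] := by
    funext i; fin_cases i <;> rfl
  have h3 : (![a, b, c, e] : Tup R 3) ∘ (3 : Fin 4).succAbove = ![a, b, c] := by
    funext i; fin_cases i <;> rfl
  rw [bdE_single, Fin.sum_univ_four, h0, h1, h2, h3]
  norm_num
  abel

theorem bdE_three_vec (a b c e f : V2 R) :
    bdE R 3 (Finsupp.single ![a, b, c, e, f] 1) = Finsupp.single ![b, c, e, f] 1
      - Finsupp.single ![a, c, e, f] 1 + Finsupp.single ![a, b, e, f] 1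
      - Finsupp.single ![a, b, c, f] 1 + Finsupp.single ![a, b, c, e] 1 := by
  have h0 : (![a, b, c, e, f] : Tup R 4) ∘ (0 : Fin 5).succAbove = ![b, c, e, f] := by
    funext i; fin_cases i <;> rfl
  have h1 : (![a, b, c, e, f] : Tup R 4) ∘ (1 : Fin 5).succAbove = ![a, c, e, f] := by
    funext i; fin_cases i <;> rfl
  have h2 : (![a, b, c, e, f] : Tup R 4) ∘ (2 : Fin 5).succAbove = ![a, b, e, f] := by
    funext i; fin_cases i <;> rfl
  have h3 : (![a, b, c, e, f] : Tup R 4) ∘ (3 : Fin 5).succAbove = ![a, b, c, f] := by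
    funext i; fin_cases i <;> rfl
  have h4 : (![a, b, c, e, f] : Tup R 4) ∘ (4 : Fin 5).succAbove = ![a, b, c, e] := by
    funext i; fin_cases i <;> rfl
  rw [bdE_single, Fin.sum_univ_five, h0, h1, h2, h3, h4]
  norm_num
  abel

theorem bdE_faces (a b c e f : V2 R) :
    bdE R 2 (Finsupp.single ![b, c, e, f] 1 - Finsupp.single ![a, c, e, f] 1
      + Finsupp.single ![a, b, e, f] 1 - Finsupp.single ![a, b, c, f] 1
      + Finsupp.single ![a, b, c, e] 1) = 0 := by
  simp only [map_add, map_sub, bdE_two_vec]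
  abel

theorem eq_vec_four {α : Type*} (v : Fin 4 → α) : v = ![v 0, v 1, v 2, v 3] := by
  funext i; fin_cases i <;> rfl

theorem bdE_mapDomain_gT {l : ℕ} (g : GL (Fin 2) R) (x : EE R (l + 1)) :
    bdE R l (Finsupp.mapDomain (gT R g) x) = Finsupp.mapDomain (gT R g) (bdE R l x) := by
  induction x using Finsupp.induction_linear with
  | zero => simp
  | add x y hx hy => simp only [Finsupp.mapDomain_add, map_add, hx, hy]
  | single v n =>
    rw [Finsupp.mapDomain_single, bdE_single, bdE_single, Finsupp.mapDomain_finsetSum]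
    refine Finset.sum_congr rfl fun i _ => ?_
    rw [Finsupp.mapDomain_smul, Finsupp.mapDomain_single]
    rfl

/-- Appending `w` to a quadruple of vectors and taking the boundary. -/
theorem bdE_append (w : V2 R) (x : EE R 3) :
    bdE R 3 (Finsupp.mapDomain (fun v : Tup R 3 => ![v 0, v 1, v 2, v 3, w]) x) =
      Finsupp.mapDomain (fun v : Tup R 2 => (![v 0, v 1, v 2, w] : Tup R 3)) (bdE R 2 x) + x := by
  have hx : ((bdE R 3).comp (Finsupp.mapDomain.addMonoidHom
      (fun v : Tup R 3 => (![v 0, v 1, v 2, v 3, w] : Tup R 4)))) =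
      (Finsupp.mapDomain.addMonoidHom
        (fun v : Tup R 2 => (![v 0, v 1, v 2, w] : Tup R 3))).comp (bdE R 2) +
        AddMonoidHom.id _ := by
    refine Finsupp.addHom_ext' fun v => AddMonoidHom.ext_int ?_
    obtain ⟨a, b, c, e, rfl⟩ : ∃ a b c e, v = ![a, b, c, e] := ⟨_, _, _, _, eq_vec_four v⟩
    simp only [AddMonoidHom.comp_apply, AddMonoidHom.add_apply, AddMonoidHom.id_apply,
      Finsupp.singleAddHom_apply, Finsupp.mapDomain.addMonoidHom_apply, bdE_two_vec,
      Finsupp.mapDomain_single, map_add, map_sub]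
    exact bdE_three_vec a b c e w
  exact DFunLike.congr_fun hx x

end Boundary

section Coinvariants

variable {R : Type} [CommRing R]

/-- The quadruple of vectors `(e₁, e₂, a, λa)` attached to the symbol `[a₁, a₂; λ₁, λ₂]`. -/
def stdTup (q : PIdx R) : Tup R 3 :=
  ![![1, 0], ![0, 1], ![q.1.1, q.1.2.1], ![q.1.2.2.1 * q.1.1, q.1.2.2.2 * q.1.2.1]]

theorem hasCoord_stdTup (q : PIdx R) : HasCoord (stdTup q) q := by
  refine hasCoord_vec_iff.2 ⟨by simp [det2], ?_, ?_⟩ <;> simp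

/-- The chain of quadruples attached to a combination of symbols. -/
noncomputable def stdChain : (PIdx R →₀ ℤ) →+ EE R 3 :=
  Finsupp.mapDomain.addMonoidHom stdTup

theorem stdChain_single (q : PIdx R) (n : ℤ) :
    stdChain (Finsupp.single q n) = Finsupp.single (stdTup q) n :=
  Finsupp.mapDomain_single

theorem single_mem_DD {v : Tup R 3} (h : IsFrame R v) (n : ℤ) : Finsupp.single v n ∈ DD R 3 :=
  Finsupp.single_mem_supported ℤ n h

theorem stdChain_mem_DD (x : PIdx R →₀ ℤ) : stdChain x ∈ DD R 3 := by
  induction x using Finsupp.induction_linear with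
  | zero => simp
  | add x y hx hy => rw [map_add]; exact add_mem hx hy
  | single q n => rw [stdChain_single]; exact single_mem_DD (hasCoord_stdTup q).isFrame n

theorem HasCoord.exists_gT_stdTup {v : Tup R 3} {q : PIdx R} (h : HasCoord v q) :
    ∃ g : GL (Fin 2) R, gT R g (stdTup q) = v := by
  obtain ⟨hd, e2, e3⟩ := h
  let A : Matrix (Fin 2) (Fin 2) R := !![v 0 0, v 1 0; v 0 1, v 1 1]
  have hA : IsUnit A := by
    rw [Matrix.isUnit_iff_isUnit_det]
    convert hd using 1
    simp only [A, Matrix.det_fin_two_of, det2]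
    ring
  refine ⟨hA.unit, ?_⟩
  rw [eq_vec_four v, e2, e3]
  funext i
  simp only [gT, IsUnit.unit_spec]
  fin_cases i <;> rw [V2.ext_iff'] <;>
    simp [stdTup, A, Matrix.mulVec, dotProduct, Fin.sum_univ_two, mul_comm]

theorem HasCoord.bdE_sub_mem {v : Tup R 3} {q : PIdx R} (h : HasCoord v q) :
    bdE R 2 (Finsupp.single v 1) - bdE R 2 (stdChain (Finsupp.single q 1)) ∈
      coinvOf R 2 ((DD R 3).map (bdE R 2)) := by
  obtain ⟨g, rfl⟩ := h.exists_gT_stdTup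
  refine AddSubgroup.subset_closure
    ⟨g, bdE R 2 (stdChain (Finsupp.single q 1)), ⟨_, stdChain_mem_DD _, rfl⟩, ?_⟩
  rw [← bdE_mapDomain_gT, stdChain_single, Finsupp.mapDomain_single]

theorem bdE_stdChain_mem_of_faces {v0 v1 v2 v3 w : V2 R} {q1 q2 q3 q4 : PIdx R}
    (h1 : HasCoord ![v1, v2, v3, w] q1) (h2 : HasCoord ![v0, v2, v3, w] q2)
    (h3 : HasCoord ![v0, v1, v3, w] q3) (h4 : HasCoord ![v0, v1, v2, w] q4) :
    bdE R 2 (Finsupp.single ![v0, v1, v2, v3] 1) + bdE R 2 (stdChain (Finsupp.single q1 1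
      - Finsupp.single q2 1 + Finsupp.single q3 1 - Finsupp.single q4 1)) ∈
      coinvOf R 2 ((DD R 3).map (bdE R 2)) := by
  have h := bdE_faces v0 v1 v2 v3 w
  simp only [map_add, map_sub] at h ⊢
  have := neg_mem (sub_mem (add_mem (sub_mem h1.bdE_sub_mem h2.bdE_sub_mem) h3.bdE_sub_mem)
    h4.bdE_sub_mem)
  rw [← add_zero (-_), ← h] at this
  convert this using 1
  abel

theorem bdE_stdChain_mem_of_mem_PRel {x : PIdx R →₀ ℤ} (hx : x ∈ PRel R) :
    bdE R 2 (stdChain x) ∈ coinvOf R 2 ((DD R 3).map (bdE R 2)) := by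
  have hle : PRel R ≤ (coinvOf R 2 ((DD R 3).map (bdE R 2))).comap ((bdE R 2).comp stdChain) := by
    refine (AddSubgroup.closure_le _).2 ?_
    rintro _ ⟨a1, a2, l1, l2, g1, g2, q1, q2, q3, q4, q5, ha1, ha2, hl1, hl2, -, -, -, -, -, -, hl,
      -, -, -, -, -, e1, e2, e3, e4, e5, rfl⟩
    obtain ⟨v0, v1, h01⟩ : ∃ v0 v1 : V2 R, IsUnit (det2 v0 v1) :=
      ⟨![1, 0], ![0, 1], by simp [det2]⟩
    obtain ⟨v2, i2⟩ : ∃ v2, v2 = a1 • v0 + a2 • v1 := ⟨_, rfl⟩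
    obtain ⟨v3, i3⟩ : ∃ v3, v3 = (l1 * a1) • v0 + (l2 * a2) • v1 := ⟨_, rfl⟩
    obtain ⟨w, iw⟩ : ∃ w, w = (g1 * a1) • v0 + (g2 * a2) • v1 := ⟨_, rfl⟩
    have h02 : IsUnit (det2 v0 v2) := by
      convert ha2.mul h01 using 1
      simp only [i2, det2, Pi.add_apply, Pi.smul_apply, smul_eq_mul]; ring
    have h12 : IsUnit (det2 v1 v2) := by
      convert (ha1.mul h01).neg using 1
      simp only [i2, det2, Pi.add_apply, Pi.smul_apply, smul_eq_mul]; ring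
    obtain ⟨⟨f1, f1'⟩, ⟨f2, f2'⟩, f3⟩ := face_smul_eqs hl1 hl2 hl i2 i3 iw
    have h1 : HasCoord ![v1, v2, v3, w] q1 := ⟨h12, by rw [e1]; exact f1, by rw [e1]; exact f1'⟩
    have h2 : HasCoord ![v0, v2, v3, w] q2 := ⟨h02, by rw [e2]; exact f2, by rw [e2]; exact f2'⟩
    have h3 : HasCoord ![v0, v1, v3, w] q3 := ⟨h01, by rw [e3]; exact i3, by rw [e3]; exact f3⟩
    have h4 : HasCoord ![v0, v1, v2, w] q4 := ⟨h01, by rw [e4]; exact i2, by rw [e4]; exact iw⟩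
    have h5 : HasCoord ![v0, v1, v2, v3] q5 := ⟨h01, by rw [e5]; exact i2, by rw [e5]; exact i3⟩
    have := sub_mem (bdE_stdChain_mem_of_faces h1 h2 h3 h4) h5.bdE_sub_mem
    rw [SetLike.mem_coe, AddSubgroup.mem_comap, AddMonoidHom.comp_apply]
    rw [map_add stdChain, map_add]
    convert this using 1
    abel
  exact hle hx

open Classical in
/-- The class in `PPres R` of a chain of quadruples of vectors; quadruples without
coordinates are sent to `0`. -/
noncomputable def symbolClass : EE R 3 →+ PPres R :=
  Finsupp.liftAddHom fun v => zmultiplesHom _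
    (if h : ∃ q, HasCoord v q then (QuotientAddGroup.mk (Finsupp.single h.choose 1)) else 0)

theorem HasCoord.symbolClass_single {v : Tup R 3} {q : PIdx R} (h : HasCoord v q) (n : ℤ) :
    symbolClass (Finsupp.single v n) = n • QuotientAddGroup.mk (Finsupp.single q 1) := by
  have hex : ∃ q, HasCoord v q := ⟨q, h⟩
  simp [symbolClass, hex, hex.choose_spec.unique h]

theorem symbolClass_stdChain (x : PIdx R →₀ ℤ) :
    symbolClass (stdChain x) = QuotientAddGroup.mk x := by
  have : symbolClass.comp stdChain = QuotientAddGroup.mk' (PRel R) := by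
    refine Finsupp.addHom_ext' fun q => AddMonoidHom.ext_int ?_
    simp [stdChain_single, (hasCoord_stdTup q).symbolClass_single]
  exact DFunLike.congr_fun this x

theorem hasCoord_gT {v : Tup R 3} {q : PIdx R} (h : HasCoord v q) (g : GL (Fin 2) R) :
    HasCoord (gT R g v) q := by
  obtain ⟨hd, e2, e3⟩ := h
  refine ⟨?_, ?_, ?_⟩
  · convert (((Matrix.isUnit_iff_isUnit_det _).1 g.isUnit).mul hd) using 1
    simp [det2, gT, Matrix.mulVec, dotProduct, Fin.sum_univ_two, Matrix.det_fin_two]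
    ring
  · simp only [gT, e2, Matrix.mulVec_add, Matrix.mulVec_smul]
  · simp only [gT, e3, Matrix.mulVec_add, Matrix.mulVec_smul]

variable (R) in
/-- Chains supported on the quadruples of vectors that have coordinates. -/
noncomputable def coordChains : AddSubgroup (EE R 3) :=
  (Finsupp.supported ℤ ℤ {v : Tup R 3 | ∃ q, HasCoord v q}).toAddSubgroup

theorem HasCoord.single_mem_coordChains {v : Tup R 3} {q : PIdx R} (h : HasCoord v q) (n : ℤ) :
    Finsupp.single v n ∈ coordChains R :=
  Finsupp.single_mem_supported ℤ n (show ∃ q, HasCoord v q from ⟨q, h⟩)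

theorem coordChains_induction {p : EE R 3 → Prop} (h0 : p 0)
    (hadd : ∀ x y, p x → p y → p (x + y))
    (hsingle : ∀ v q n, HasCoord v q → p (Finsupp.single v n)) {x : EE R 3}
    (hx : x ∈ coordChains R) : p x := by
  rw [← Finsupp.sum_single x]
  refine Finset.sum_induction _ p hadd h0 fun v hv => ?_
  obtain ⟨q, hq⟩ : ∃ q, HasCoord v q := hx hv
  exact hsingle v q _ hq

theorem stdChain_mem_coordChains (x : PIdx R →₀ ℤ) : stdChain x ∈ coordChains R := by
  induction x using Finsupp.induction_linear with
  | zero => simp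
  | add x y hx hy => rw [map_add]; exact add_mem hx hy
  | single q n => rw [stdChain_single]; exact (hasCoord_stdTup q).single_mem_coordChains n

theorem mapDomain_gT_of_mem_coordChains (g : GL (Fin 2) R) {x : EE R 3} (hx : x ∈ coordChains R) :
    Finsupp.mapDomain (gT R g) x ∈ coordChains R ∧
      symbolClass (Finsupp.mapDomain (gT R g) x) = symbolClass x := by
  refine coordChains_induction (p := fun x => Finsupp.mapDomain (gT R g) x ∈ coordChains R ∧
      symbolClass (Finsupp.mapDomain (gT R g) x) = symbolClass x) ?_ ?_ ?_ hx
  · simp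
  · rintro x y ⟨hx, hx'⟩ ⟨hy, hy'⟩
    rw [Finsupp.mapDomain_add, map_add, map_add, hx', hy']
    exact ⟨add_mem hx hy, rfl⟩
  · intro v q n h
    rw [Finsupp.mapDomain_single, h.symbolClass_single, (hasCoord_gT h g).symbolClass_single]
    exact ⟨(hasCoord_gT h g).single_mem_coordChains n, rfl⟩

theorem symbolClass_eq_zero_of_cycle (hR : ManyUnits R) {x : EE R 3} (hx : x ∈ coordChains R)
    (hb : bdE R 2 x = 0) : symbolClass x = 0 := by
  have hc : ∀ v : x.support, ∃ q, HasCoord (v : Tup R 3) q := fun v => hx v.2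
  choose q hq using hc
  obtain ⟨w, hw⟩ := hR.exists_generic (fun v : x.support => (v : Tup R 3))
    (fun v => (hq v).isFrame) (fun v => (q v).1.2.2.1 * det2 (v.1 0) (v.1 2))
    (fun v => (q v).1.2.2.2 * det2 (v.1 1) (v.1 2))
  have happ := bdE_append w x
  rw [hb, Finsupp.mapDomain_zero, zero_add] at happ
  rw [← happ]
  nth_rewrite 1 [← Finsupp.sum_single x]
  rw [Finsupp.sum, Finsupp.mapDomain_finsetSum, map_sum, map_sum]
  refine Finset.sum_eq_zero fun v hv => ?_
  obtain ⟨hg, hp, hr⟩ := hw ⟨v, hv⟩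
  have h5 := hq ⟨v, hv⟩
  generalize q ⟨v, hv⟩ = q5 at *
  generalize x v = n
  obtain ⟨v0, v1, v2, v3, rfl⟩ : ∃ a b c e, v = ![a, b, c, e] := ⟨_, _, _, _, eq_vec_four v⟩
  obtain ⟨q1, q2, q3, q4, h1, h2, h3, h4⟩ := hg.exists_hasCoord_faces h5.isFrame
  have hrel := relation_mem_PRel h1 h2 h3 h4 h5 hg hp hr
  rw [← QuotientAddGroup.eq_zero_iff] at hrel
  rw [Finsupp.mapDomain_single, ← mul_one n, ← smul_eq_mul, ← Finsupp.smul_single, map_zsmul,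
    map_zsmul]
  change n • symbolClass (bdE R 3 (Finsupp.single ![v0, v1, v2, v3, w] 1)) = 0
  rw [bdE_three_vec]
  simp only [map_add, map_sub, h1.symbolClass_single, h2.symbolClass_single,
    h3.symbolClass_single, h4.symbolClass_single, h5.symbolClass_single, one_smul]
  exact (congrArg (n • ·) hrel).trans (smul_zero n)

theorem exists_bdE_coordChain (hR : ManyUnits R) {x : EE R 3} (hx : x ∈ DD R 3) :
    ∃ y ∈ coordChains R, bdE R 2 y = bdE R 2 x := by
  change bdE R 2 x ∈ (coordChains R).map (bdE R 2)
  rw [← Finsupp.sum_single x, Finsupp.sum, map_sum]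
  refine sum_mem fun v hv => ?_
  have hf : IsFrame R v := hx hv
  obtain ⟨w, hw⟩ := hR.exists_generic (fun _ : Unit => v) (fun _ => hf) 0 0
  have hg := (hw ()).1
  generalize x v = n
  obtain ⟨v0, v1, v2, v3, rfl⟩ : ∃ a b c e, v = ![a, b, c, e] := ⟨_, _, _, _, eq_vec_four v⟩
  obtain ⟨q1, q2, q3, q4, h1, h2, h3, h4⟩ := hg.exists_hasCoord_faces hf
  rw [← mul_one n, ← smul_eq_mul, ← Finsupp.smul_single, map_zsmul]
  refine zsmul_mem (AddSubgroup.mem_map.2 ⟨_, neg_mem (sub_mem (add_mem (sub_mem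
    (h1.single_mem_coordChains 1) (h2.single_mem_coordChains 1)) (h3.single_mem_coordChains 1))
    (h4.single_mem_coordChains 1)), ?_⟩) n
  have h := bdE_faces v0 v1 v2 v3 w
  rw [map_add] at h
  rw [map_neg]
  exact neg_eq_of_add_eq_zero_right h

theorem exists_bdE_of_mem_coinvOf (hR : ManyUnits R) {c : EE R 2}
    (hc : c ∈ coinvOf R 2 ((DD R 3).map (bdE R 2))) :
    ∃ y ∈ coordChains R, bdE R 2 y = c ∧ symbolClass y = 0 := by
  suffices h : coinvOf R 2 ((DD R 3).map (bdE R 2)) ≤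
      (coordChains R ⊓ symbolClass.ker).map (bdE R 2) by
    obtain ⟨y, ⟨hy, hy'⟩, rfl⟩ := h hc
    exact ⟨y, hy, rfl, hy'⟩
  refine (AddSubgroup.closure_le _).2 ?_
  rintro _ ⟨g, _, ⟨x, hx, rfl⟩, rfl⟩
  obtain ⟨y, hy, hyx⟩ := exists_bdE_coordChain hR hx
  obtain ⟨hm, hs⟩ := mapDomain_gT_of_mem_coordChains g hy
  refine AddSubgroup.mem_map.2 ⟨Finsupp.mapDomain (gT R g) y - y,
    AddSubgroup.mem_inf.2 ⟨sub_mem hm hy, AddMonoidHom.mem_ker.2 ?_⟩, ?_⟩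
  · rw [map_sub, hs, sub_self]
  · rw [map_sub, bdE_mapDomain_gT, hyx]

theorem mem_PRel_iff (hR : ManyUnits R) {x : PIdx R →₀ ℤ} :
    x ∈ PRel R ↔ bdE R 2 (stdChain x) ∈ coinvOf R 2 ((DD R 3).map (bdE R 2)) := by
  refine ⟨bdE_stdChain_mem_of_mem_PRel, fun h => ?_⟩
  obtain ⟨y, hy, hyx, hy0⟩ := exists_bdE_of_mem_coinvOf hR h
  have := symbolClass_eq_zero_of_cycle hR (sub_mem (stdChain_mem_coordChains x) hy)
    (by rw [map_sub, hyx, sub_self])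
  rw [map_sub, hy0, sub_zero, symbolClass_stdChain] at this
  exact (QuotientAddGroup.eq_zero_iff x).1 this

theorem exists_bdE_sub_stdChain_mem (hR : ManyUnits R) {x : EE R 3} (hx : x ∈ DD R 3) :
    ∃ y, bdE R 2 x - bdE R 2 (stdChain y) ∈ coinvOf R 2 ((DD R 3).map (bdE R 2)) := by
  obtain ⟨z, hz, hzx⟩ := exists_bdE_coordChain hR hx
  rw [← hzx]
  refine coordChains_induction (p := fun z => ∃ y, bdE R 2 z - bdE R 2 (stdChain y) ∈
    coinvOf R 2 ((DD R 3).map (bdE R 2))) ⟨0, by simp⟩ ?_ ?_ hz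
  · rintro a b ⟨y, hy⟩ ⟨y', hy'⟩
    refine ⟨y + y', ?_⟩
    simp only [map_add, add_sub_add_comm]
    exact add_mem hy hy'
  · intro v q n h
    refine ⟨n • Finsupp.single q 1, ?_⟩
    have := zsmul_mem h.bdE_sub_mem n
    rw [← mul_one n, ← smul_eq_mul, ← Finsupp.smul_single, map_zsmul, smul_eq_mul, mul_one,
      map_zsmul, map_zsmul, ← smul_sub]
    exact this

variable (R) in
/-- The map sending the symbol `[a₁, a₂; λ₁, λ₂]` to the class of the boundary of
`(e₁, e₂, a, λa)`. -/
noncomputable def symbolHom : (PIdx R →₀ ℤ) →+ H0 R 2 ((DD R 3).map (bdE R 2)) :=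
  (QuotientAddGroup.mk' _).comp
    (((bdE R 2).comp stdChain).codRestrict ((DD R 3).map (bdE R 2))
      fun x => ⟨_, stdChain_mem_DD x, rfl⟩)

theorem symbolHom_ker (hR : ManyUnits R) : (symbolHom R).ker = PRel R := by
  ext x
  rw [mem_PRel_iff hR, AddMonoidHom.mem_ker]
  exact QuotientAddGroup.eq_zero_iff _

theorem symbolHom_surjective (hR : ManyUnits R) : Function.Surjective (symbolHom R) := by
  intro c
  obtain ⟨⟨_, x, hx, rfl⟩, rfl⟩ := QuotientAddGroup.mk_surjective c
  obtain ⟨y, hy⟩ := exists_bdE_sub_stdChain_mem hR hx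
  refine ⟨y, QuotientAddGroup.eq.2 ?_⟩
  change -bdE R 2 (stdChain y) + bdE R 2 x ∈ coinvOf R 2 ((DD R 3).map (bdE R 2))
  rwa [neg_add_eq_sub]

end Coinvariants

/-- For a ring with many units, the coinvariants
`𝒫(R) = H₀(GL₂(R), ∂₃(D₃(R²)))` are isomorphic to the group presented by generators
`[a₁,a₂;λ₁,λ₂]` (`a₁, a₂, λ₁, λ₂, 1-λ₁, 1-λ₂, λ₁-λ₂ ∈ R^×`) and the relations of
Lemma 2.1 of the paper. -/
theorem stmt0 (R : Type) [CommRing R] (hR : ManyUnits R) :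
    Nonempty (H0 R 2 ((DD R 3).map (bdE R 2)) ≃+ PPres R) := by
  exact ⟨((QuotientAddGroup.quotientAddEquivOfEq (symbolHom_ker hR)).symm.trans
    (QuotientAddGroup.quotientKerEquivOfSurjective _ (symbolHom_surjective hR))).symm⟩
end

section
/- Let R be a commutative ring and let a_1, a_2, λ_1, λ_2 ∈ R^× be units such that 1−λ_1, 1−λ_2 and λ_1−λ_2 are also units. Then in the group (R^× ⊗ R^×)_σ the following equalities hold: ((λ_2−λ_1)a_2) ⊗ λ_1 − ((λ_1−λ_2)a_1) ⊗ λ_2 + (λ_1a_1) ⊗ (λ_2a_2) − a_1 ⊗ a_2 = (1−λ_1λ_2^{-1}) ⊗ (λ_1λ_2^{-1}) − (−λ_2) ⊗ λ_2 = −(1−λ_2λ_1^{-1}) ⊗ (λ_2λ_1^{-1}) + (−λ_1) ⊗ λ_1. -/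
/-- `R^× ⊗_ℤ R^×`: the tensor square of the (additively written) abelian group of
units of `R`. -/
abbrev TT (R : Type) [CommRing R] : Type :=
  TensorProduct ℤ (Additive Rˣ) (Additive Rˣ)

/-- The elementary tensor `a ⊗ b` for units `a b : Rˣ`. -/
noncomputable def tmulU (R : Type) [CommRing R] (a b : Rˣ) : TT R :=
  TensorProduct.tmul ℤ (Additive.ofMul a) (Additive.ofMul b)

/-- The subgroup of `R^× ⊗ R^×` generated by the elements `a ⊗ b + b ⊗ a`. -/
noncomputable def sigmaSub (R : Type) [CommRing R] : AddSubgroup (TT R) :=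
  AddSubgroup.closure {x | ∃ a b : Rˣ, x = tmulU R a b + tmulU R b a}

/-- `(R^× ⊗ R^×)_σ`. -/
abbrev Tsigma (R : Type) [CommRing R] : Type := TT R ⧸ sigmaSub R

/-- Canonical projection onto `(R^× ⊗ R^×)_σ`. -/
noncomputable def clsS (R : Type) [CommRing R] : TT R →+ Tsigma R :=
  QuotientAddGroup.mk' _

/-- The subgroup of `R^× ⊗ R^×` generated by the elements `a ⊗ (-a)`. -/
noncomputable def sbarSub (R : Type) [CommRing R] : AddSubgroup (TT R) :=
  AddSubgroup.closure {x | ∃ a : Rˣ, x = tmulU R a (-a)}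

/-- `(R^× ⊗ R^×)_σ̄`. -/
abbrev Tsigmabar (R : Type) [CommRing R] : Type := TT R ⧸ sbarSub R

/-- Canonical projection onto `(R^× ⊗ R^×)_σ̄`. -/
noncomputable def clsSb (R : Type) [CommRing R] : TT R →+ Tsigmabar R :=
  QuotientAddGroup.mk' _

/-- The subgroup of `R^× ⊗ R^×` generated by the elements `a ⊗ (1-a)`
with `a`, `1-a` units. -/
noncomputable def k2Sub (R : Type) [CommRing R] : AddSubgroup (TT R) :=
  AddSubgroup.closure {x | ∃ a b : Rˣ, (b : R) = 1 - (a : R) ∧ x = tmulU R a b}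

/-- The Milnor K-group `K_2^M(R)`. -/
abbrev K2M (R : Type) [CommRing R] : Type := TT R ⧸ k2Sub R

/-- Canonical projection onto `K_2^M(R)`; `clsK R (tmulU R a b)` is the symbol `{a, b}`. -/
noncomputable def clsK (R : Type) [CommRing R] : TT R →+ K2M R :=
  QuotientAddGroup.mk' _

theorem tmulU_mul_left (R : Type) [CommRing R] (a b c : Rˣ) :
    tmulU R (a * b) c = tmulU R a c + tmulU R b c := by
  simp [tmulU, TensorProduct.add_tmul]

theorem tmulU_mul_right (R : Type) [CommRing R] (a b c : Rˣ) :
    tmulU R a (b * c) = tmulU R a b + tmulU R a c := by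
  simp [tmulU, TensorProduct.tmul_add]

theorem tmulU_inv_left (R : Type) [CommRing R] (a b : Rˣ) :
    tmulU R a⁻¹ b = -tmulU R a b := by
  simp [tmulU, TensorProduct.neg_tmul]

theorem tmulU_inv_right (R : Type) [CommRing R] (a b : Rˣ) :
    tmulU R a b⁻¹ = -tmulU R a b := by
  simp [tmulU, TensorProduct.tmul_neg]

theorem tmulU_neg_one_add_self (R : Type) [CommRing R] (a : Rˣ) :
    tmulU R (-1) a + tmulU R (-1) a = 0 := by
  rw [← tmulU_mul_left]
  simp [tmulU]

theorem clsS_tmulU_swap (R : Type) [CommRing R] (a b : Rˣ) :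
    clsS R (tmulU R b a) = -clsS R (tmulU R a b) := by
  rw [eq_neg_iff_add_eq_zero, ← map_add]
  exact (QuotientAddGroup.eq_zero_iff _).2 (AddSubgroup.subset_closure ⟨b, a, rfl⟩)

/-- Sublemma 2.2 of the paper: for units `a₁ a₂ λ₁ λ₂` with
`1-λ₁`, `1-λ₂`, `λ₁-λ₂` units, in `(R^× ⊗ R^×)_σ` one has
`((λ₂-λ₁)a₂) ⊗ λ₁ - ((λ₁-λ₂)a₁) ⊗ λ₂ + (λ₁a₁) ⊗ (λ₂a₂) - a₁ ⊗ a₂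
  = (1-λ₁λ₂⁻¹) ⊗ (λ₁λ₂⁻¹) - (-λ₂) ⊗ λ₂ = -(1-λ₂λ₁⁻¹) ⊗ (λ₂λ₁⁻¹) + (-λ₁) ⊗ λ₁`. -/
theorem stmt5 (R : Type) [CommRing R] (a1 a2 l1 l2 : Rˣ)
    (h1 : IsUnit ((1 : R) - (l1 : R))) (h2 : IsUnit ((1 : R) - (l2 : R)))
    (h3 : IsUnit ((l1 : R) - (l2 : R)))
    (u v w w' : Rˣ)
    (hu : (u : R) = ((l2 : R) - (l1 : R)) * (a2 : R))
    (hv : (v : R) = ((l1 : R) - (l2 : R)) * (a1 : R))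
    (hw : (w : R) = 1 - (l1 : R) * Ring.inverse (l2 : R))
    (hw' : (w' : R) = 1 - (l2 : R) * Ring.inverse (l1 : R)) :
    clsS R (tmulU R u l1 - tmulU R v l2 + tmulU R (l1 * a1) (l2 * a2) - tmulU R a1 a2)
        = clsS R (tmulU R w (l1 * l2⁻¹) - tmulU R (-l2) l2) ∧
    clsS R (tmulU R w (l1 * l2⁻¹) - tmulU R (-l2) l2)
        = clsS R (-tmulU R w' (l2 * l1⁻¹) + tmulU R (-l1) l1) := by
  obtain ⟨d, hd⟩ := h3
  have hu' : u = -1 * d * a2 := by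
    ext
    simp only [Units.val_mul, Units.val_neg, Units.val_one, hu, hd]
    ring
  have hv' : v = d * a1 := by
    ext
    simp only [Units.val_mul, hv, hd]
  have hw1 : w = -1 * d * l2⁻¹ := by
    ext
    have h := l2.mul_inv
    simp only [Units.val_mul, Units.val_neg, Units.val_one, hw, hd, Ring.inverse_unit]
    linear_combination -h
  have hw2 : w' = d * l1⁻¹ := by
    ext
    have h := l1.mul_inv
    simp only [Units.val_mul, hw', hd, Ring.inverse_unit]
    linear_combination -h
  have hε := congrArg (clsS R) (tmulU_neg_one_add_self R l2)
  rw [map_add, map_zero] at hε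
  rw [hu', hv', hw1, hw2, ← neg_one_mul l1, ← neg_one_mul l2]
  simp only [tmulU_mul_left, tmulU_mul_right, tmulU_inv_left, tmulU_inv_right, map_add, map_sub,
    map_neg, clsS_tmulU_swap R l1 a2, clsS_tmulU_swap R l1 l2]
  constructor
  · rw [← sub_eq_zero, ← hε]
    abel
  · rw [← sub_eq_zero, ← neg_eq_zero, ← hε]
    abel
end

section
/- Let R be a commutative ring with many units. Let S(R) be the abelian group presented by generators [a_1, a_2] for a_1, a_2 ∈ R^× and relations [(λ_2−λ_1)a_2, λ_1] − [(λ_1−λ_2)a_1, λ_2] + [λ_1a_1, λ_2a_2] − [a_1, a_2] = 0 whenever a_1, a_2, λ_1, λ_2, 1−λ_1, 1−λ_2, λ_1−λ_2 ∈ R^×. Then the assignment [a, b] ↦ {a, b} (the class of a ⊗ b in K_2^M(R)) is a well-defined group homomorphism φ : S(R) → K_2^M(R). -/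
/-- The subgroup of relations defining `S(R)`: generated by the elements
`[(λ₂-λ₁)a₂, λ₁] - [(λ₁-λ₂)a₁, λ₂] + [λ₁a₁, λ₂a₂] - [a₁, a₂]`
for units `a₁ a₂ λ₁ λ₂` with `1-λ₁`, `1-λ₂`, `λ₁-λ₂` units. -/
noncomputable def SRel (R : Type) [CommRing R] : AddSubgroup ((Rˣ × Rˣ) →₀ ℤ) :=
  AddSubgroup.closure
    {x | ∃ a1 a2 l1 l2 u v : Rˣ,
      IsUnit ((1 : R) - (l1 : R)) ∧ IsUnit ((1 : R) - (l2 : R)) ∧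
      IsUnit ((l1 : R) - (l2 : R)) ∧
      (u : R) = ((l2 : R) - (l1 : R)) * (a2 : R) ∧
      (v : R) = ((l1 : R) - (l2 : R)) * (a1 : R) ∧
      x = Finsupp.single (u, l1) 1 - Finsupp.single (v, l2) 1
          + Finsupp.single (l1 * a1, l2 * a2) 1 - Finsupp.single (a1, a2) 1}

/-- The group `S(R)` presented by generators `[a₁, a₂]`, `a₁ a₂ ∈ R^×`, and the above
relations. -/
abbrev SPres (R : Type) [CommRing R] : Type := ((Rˣ × Rˣ) →₀ ℤ) ⧸ SRel R

section Symbols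

variable {R : Type} [CommRing R]

theorem clsK_mul_left (a b c : Rˣ) :
    clsK R (tmulU R (a * b) c) = clsK R (tmulU R a c) + clsK R (tmulU R b c) := by
  rw [← map_add, tmulU, ofMul_mul, TensorProduct.add_tmul]; rfl

theorem clsK_mul_right (a b c : Rˣ) :
    clsK R (tmulU R a (b * c)) = clsK R (tmulU R a b) + clsK R (tmulU R a c) := by
  rw [← map_add, tmulU, ofMul_mul, TensorProduct.tmul_add]; rfl

theorem clsK_one_left (c : Rˣ) : clsK R (tmulU R 1 c) = 0 := by
  simpa using clsK_mul_left 1 1 c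

theorem clsK_one_right (c : Rˣ) : clsK R (tmulU R c 1) = 0 := by
  simpa using clsK_mul_right c 1 1

theorem clsK_inv_left (a c : Rˣ) : clsK R (tmulU R a⁻¹ c) = -clsK R (tmulU R a c) := by
  rw [eq_neg_iff_add_eq_zero, ← clsK_mul_left, inv_mul_cancel, clsK_one_left]

theorem clsK_inv_right (c a : Rˣ) : clsK R (tmulU R c a⁻¹) = -clsK R (tmulU R c a) := by
  rw [eq_neg_iff_add_eq_zero, ← clsK_mul_right, inv_mul_cancel, clsK_one_right]

/-- The Steinberg relation. -/
theorem clsK_eq_zero_of_add_eq_one {a b : Rˣ} (h : (a : R) + b = 1) :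
    clsK R (tmulU R a b) = 0 :=
  (QuotientAddGroup.eq_zero_iff _).2
    (AddSubgroup.subset_closure ⟨a, b, eq_sub_of_add_eq' h, rfl⟩)

theorem clsK_neg_self_of_isUnit_one_sub {a : Rˣ} (h : IsUnit (1 - (a : R))) :
    clsK R (tmulU R a (-a)) = 0 := by
  obtain ⟨b, hb⟩ := h
  have h₁ : clsK R (tmulU R a b) = 0 := clsK_eq_zero_of_add_eq_one (by rw [hb]; ring)
  have h₂ : clsK R (tmulU R a⁻¹ (b * (-a)⁻¹)) = 0 := by
    refine clsK_eq_zero_of_add_eq_one ?_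
    rw [inv_neg, Units.val_mul, Units.val_neg, hb]
    linear_combination a.mul_inv
  rw [clsK_inv_left, clsK_mul_right, clsK_inv_right, h₁] at h₂
  simpa using h₂

theorem clsK_mul_neg_mul (a b : Rˣ) :
    clsK R (tmulU R (a * b) (-(a * b))) =
      clsK R (tmulU R a (-a)) + clsK R (tmulU R b (-b)) +
        (clsK R (tmulU R a b) + clsK R (tmulU R b a)) := by
  have h₁ : clsK R (tmulU R a (-(a * b))) = clsK R (tmulU R a (-a)) + clsK R (tmulU R a b) := by
    rw [← clsK_mul_right, neg_mul]
  have h₂ : clsK R (tmulU R b (-(a * b))) = clsK R (tmulU R b (-b)) + clsK R (tmulU R b a) := by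
    rw [← clsK_mul_right, neg_mul, mul_comm]
  rw [clsK_mul_left, h₁, h₂]
  abel

theorem isUnit_one_sub_mul_inv {a b : Rˣ} (h : IsUnit ((b : R) - a)) :
    IsUnit (1 - ((a * b⁻¹ : Rˣ) : R)) := by
  have : 1 - ((a * b⁻¹ : Rˣ) : R) = (b - a) * (b⁻¹ : Rˣ) := by
    rw [Units.val_mul]; linear_combination -b.mul_inv
  rw [this]
  exact h.mul b⁻¹.isUnit

theorem ManyUnits.exists_units (hR : ManyUnits R) (a : Rˣ) :
    ∃ x y z : Rˣ, IsUnit ((y : R) - x) ∧ IsUnit ((z : R) - y) ∧ IsUnit ((z : R) - x) ∧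
      IsUnit ((y : R) - a * x) ∧ IsUnit ((z : R) - a * y) ∧ IsUnit ((z : R) - a * x) := by
  let p (i : Fin 3) : (Fin 3 → R) →ₗ[R] R := LinearMap.proj i
  have surj (g : (Fin 3 → R) →ₗ[R] R) (i : Fin 3) (h : g (Pi.single i 1) = 1) :
      Function.Surjective g := fun r => ⟨r • Pi.single i 1, by simp [h]⟩
  obtain ⟨v, hv⟩ := hR 3 (by norm_num) 9
    ![p 0, p 1, p 2, p 1 - p 0, p 2 - p 1, p 2 - p 0,
      p 1 - (a : R) • p 0, p 2 - (a : R) • p 1, p 2 - (a : R) • p 0] (by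
    intro i
    apply surj _ (![0, 1, 2, 1, 2, 2, 1, 2, 2] i)
    fin_cases i <;> simp [p])
  obtain ⟨x, hx⟩ := hv 0
  obtain ⟨y, hy⟩ := hv 1
  obtain ⟨z, hz⟩ := hv 2
  refine ⟨x, y, z, ?_⟩
  rw [hx, hy, hz]
  exact ⟨hv 3, hv 4, hv 5, hv 6, hv 7, hv 8⟩

theorem ManyUnits.clsK_neg_self (hR : ManyUnits R) (a : Rˣ) :
    clsK R (tmulU R a (-a)) = 0 := by
  obtain ⟨x, y, z, hxy, hyz, hxz, haxy, hayz, haxz⟩ := hR.exists_units a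
  have key {s t : Rˣ} (h : IsUnit ((t : R) - s)) (ha : IsUnit ((t : R) - a * s)) :
      clsK R (tmulU R a (-a)) +
        (clsK R (tmulU R a (s * t⁻¹)) + clsK R (tmulU R (s * t⁻¹) a)) = 0 := by
    have h₁ := clsK_mul_neg_mul a (s * t⁻¹)
    rw [← mul_assoc, clsK_neg_self_of_isUnit_one_sub
      (isUnit_one_sub_mul_inv (a := a * s) (by rwa [Units.val_mul])),
      clsK_neg_self_of_isUnit_one_sub (isUnit_one_sub_mul_inv h), add_zero] at h₁
    exact h₁.symm
  have h₁ := key hxy haxy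
  have h₂ := key hyz hayz
  have h₃ := key hxz haxz
  simp only [clsK_mul_left, clsK_mul_right, clsK_inv_left, clsK_inv_right] at h₁ h₂ h₃
  linear_combination (norm := abel) h₁ + h₂ - h₃

theorem ManyUnits.clsK_add_swap (hR : ManyUnits R) (a b : Rˣ) :
    clsK R (tmulU R a b) + clsK R (tmulU R b a) = 0 := by
  simpa [hR.clsK_neg_self] using (clsK_mul_neg_mul a b).symm

theorem ManyUnits.clsK_relation (hR : ManyUnits R) {a₁ a₂ l₁ l₂ u v : Rˣ}
    (h : IsUnit ((l₁ : R) - l₂)) (hu : (u : R) = (l₂ - l₁) * a₂)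
    (hv : (v : R) = (l₁ - l₂) * a₁) :
    clsK R (tmulU R u l₁) - clsK R (tmulU R v l₂) + clsK R (tmulU R (l₁ * a₁) (l₂ * a₂)) -
      clsK R (tmulU R a₁ a₂) = 0 := by
  obtain ⟨d, hd⟩ := h
  obtain rfl : u = -d * a₂ := Units.ext (by
    rw [hu, Units.val_mul, Units.val_neg, hd]; ring)
  obtain rfl : v = d * a₁ := Units.ext (by simp [hv, hd])
  have h₁ : clsK R (tmulU R (l₁ * l₂⁻¹) (-d * l₂⁻¹)) = 0 := by
    refine clsK_eq_zero_of_add_eq_one ?_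
    rw [Units.val_mul, Units.val_mul, Units.val_neg, hd]
    linear_combination l₂.mul_inv
  have h₂ := hR.clsK_neg_self l₂
  have h₃ : clsK R (tmulU R l₂ (-d)) = clsK R (tmulU R l₂ (-l₂)) +
      clsK R (tmulU R l₂ d) - clsK R (tmulU R l₂ l₂) := by
    rw [eq_sub_iff_add_eq, ← clsK_mul_right, ← clsK_mul_right, neg_mul, neg_mul, mul_comm]
  simp only [clsK_mul_left, clsK_mul_right, clsK_inv_left, clsK_inv_right] at h₁ ⊢
  linear_combination (norm := abel) hR.clsK_add_swap (-d) l₁ - hR.clsK_add_swap d l₂ +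
    hR.clsK_add_swap l₁ a₂ - h₁ - h₃ - h₂ + hR.clsK_add_swap l₂ l₂

end Symbols

/-- For a ring with many units, the assignment `[a, b] ↦ {a, b}` is a
well-defined homomorphism `φ : S(R) → K₂^M(R)`. -/
theorem stmt6 (R : Type) [CommRing R] (hR : ManyUnits R) :
    ∃ phi : SPres R →+ K2M R,
      ∀ a b : Rˣ,
        phi (QuotientAddGroup.mk (Finsupp.single (a, b) 1)) = clsK R (tmulU R a b) := by
  let f : ((Rˣ × Rˣ) →₀ ℤ) →+ K2M R :=
    Finsupp.liftAddHom fun p => zmultiplesHom _ (clsK R (tmulU R p.1 p.2))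
  have hf (a b : Rˣ) : f (Finsupp.single (a, b) 1) = clsK R (tmulU R a b) := by simp [f]
  refine ⟨QuotientAddGroup.lift (SRel R) f ?_, fun a b => hf a b⟩
  rw [SRel, AddSubgroup.closure_le]
  rintro _ ⟨a₁, a₂, l₁, l₂, u, v, -, -, h, hu, hv, rfl⟩
  simpa only [SetLike.mem_coe, AddMonoidHom.mem_ker, map_sub, map_add, hf] using
    hR.clsK_relation h hu hv
end

section
/- Let R be a commutative ring and let a, b ∈ R be such that a, 1−a, b, 1−b, a−b ∈ R^×. Then in R^× ⊗_ℤ R^× (written additively) one has a ⊗ (1−a) − b ⊗ (1−b) + (ba^{-1}) ⊗ (1−ba^{-1}) − ((1−a^{-1})(1−b^{-1})^{-1}) ⊗ (1−(1−a^{-1})(1−b^{-1})^{-1}) + ((1−a)(1−b)^{-1}) ⊗ (1−(1−a)(1−b)^{-1}) = a ⊗ ((1−a)(1−b)^{-1}) + ((1−a)(1−b)^{-1}) ⊗ a. Consequently the map λ : p(R) → (R^× ⊗ R^×)_σ, [a] ↦ a ⊗ (1−a), is a well-defined homomorphism. -/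
/-- The index set for the generators `[a]` of the pre-Bloch group: elements `a` of `R`
with `a` and `1 - a` units. -/
abbrev Wt (R : Type) [CommRing R] : Type := {a : R // IsUnit a ∧ IsUnit (1 - a)}

/-- The subgroup of relations of the pre-Bloch group: it is generated by the elements
`[a] - [b] + [b/a] - [(1-a⁻¹)/(1-b⁻¹)] + [(1-a)/(1-b)]` for `a, 1-a, b, 1-b, a-b` units. -/
noncomputable def pbRel (R : Type) [CommRing R] : AddSubgroup (Wt R →₀ ℤ) :=
  AddSubgroup.closure
    {x | ∃ a b c d e : Wt R, IsUnit ((a : R) - (b : R)) ∧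
      (c : R) = (b : R) * Ring.inverse (a : R) ∧
      (d : R) = (1 - Ring.inverse (a : R)) * Ring.inverse (1 - Ring.inverse (b : R)) ∧
      (e : R) = (1 - (a : R)) * Ring.inverse (1 - (b : R)) ∧
      x = Finsupp.single a 1 - Finsupp.single b 1 + Finsupp.single c 1
          - Finsupp.single d 1 + Finsupp.single e 1}

/-- The pre-Bloch group `𝔭(R)`. -/
abbrev pBloch (R : Type) [CommRing R] : Type := (Wt R →₀ ℤ) ⧸ pbRel R

/-- The generator `[a]` of the pre-Bloch group. -/
noncomputable def pcl (R : Type) [CommRing R] (a : Wt R) : pBloch R :=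
  QuotientAddGroup.mk (Finsupp.single a 1)

theorem tmulU_five_term_of_units (R : Type) [CommRing R] (a b x y u : Rˣ) :
    tmulU R a x - tmulU R b y + tmulU R (b * a⁻¹) (u * a⁻¹)
        - tmulU R (x * b * a⁻¹ * y⁻¹) (u * a⁻¹ * y⁻¹) + tmulU R (x * y⁻¹) (u * y⁻¹)
      = tmulU R a (x * y⁻¹) + tmulU R (x * y⁻¹) a := by
  simp only [tmulU_mul_left, tmulU_mul_right, tmulU_inv_left, tmulU_inv_right]
  abel

theorem one_sub_inv_units {R : Type} [CommRing R] {a x : Rˣ} (hx : (x : R) = 1 - a) :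
    1 - ((a⁻¹ : Rˣ) : R) = ((-(x * a⁻¹) : Rˣ) : R) := by
  have h : (a : R) * ((a⁻¹ : Rˣ) : R) = 1 := a.mul_inv
  push_cast
  rw [hx]
  linear_combination -h

theorem tmulU_five_term (R : Type) [CommRing R] (a b x y u c c' d d' e e' : Rˣ)
    (hx : (x : R) = 1 - a) (hy : (y : R) = 1 - b) (hu : (u : R) = a - b)
    (hc : (c : R) = b * Ring.inverse (a : R)) (hc' : (c' : R) = 1 - c)
    (hd : (d : R) = (1 - Ring.inverse (a : R)) * Ring.inverse (1 - Ring.inverse (b : R)))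
    (hd' : (d' : R) = 1 - d)
    (he : (e : R) = (1 - a) * Ring.inverse (1 - (b : R))) (he' : (e' : R) = 1 - e) :
    tmulU R a x - tmulU R b y + tmulU R c c' - tmulU R d d' + tmulU R e e'
      = tmulU R a e + tmulU R e a := by
  have ha : (a : R) * ((a⁻¹ : Rˣ) : R) = 1 := a.mul_inv
  have hyi : (y : R) * ((y⁻¹ : Rˣ) : R) = 1 := y.mul_inv
  obtain rfl : c = b * a⁻¹ := by
    ext
    rw [hc, Ring.inverse_unit, Units.val_mul]
  obtain rfl : e = x * y⁻¹ := by
    ext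
    rw [he, ← hx, ← hy, Ring.inverse_unit, Units.val_mul]
  obtain rfl : d = x * b * a⁻¹ * y⁻¹ := by
    ext
    rw [hd, Ring.inverse_unit, Ring.inverse_unit, one_sub_inv_units hx, one_sub_inv_units hy,
      Ring.inverse_unit, ← Units.val_mul]
    congr 1
    rw [inv_neg, neg_mul_neg, mul_inv, inv_inv]
    simp only [mul_assoc, mul_comm, mul_left_comm]
  obtain rfl : c' = u * a⁻¹ := by
    ext
    rw [hc', Units.val_mul, Units.val_mul, hu]
    linear_combination -ha
  obtain rfl : e' = u * y⁻¹ := by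
    ext
    rw [he', Units.val_mul, Units.val_mul, hu]
    linear_combination -hyi + ((y⁻¹ : Rˣ) : R) * (hy - hx)
  obtain rfl : d' = u * a⁻¹ * y⁻¹ := by
    ext
    rw [hd']
    push_cast
    rw [hu, hx]
    linear_combination -ha - (a : R) * ((a⁻¹ : Rˣ) : R) * hyi +
      (a : R) * ((a⁻¹ : Rˣ) : R) * ((y⁻¹ : Rˣ) : R) * hy
  exact tmulU_five_term_of_units R a b x y u

theorem clsS_tmulU_add_swap (R : Type) [CommRing R] (a b : Rˣ) :
    clsS R (tmulU R a b + tmulU R b a) = 0 :=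
  (QuotientAddGroup.eq_zero_iff _).2 (AddSubgroup.subset_closure ⟨a, b, rfl⟩)

/-- The homomorphism `[a] ↦ a ⊗ (1 - a)` on the free abelian group on `Wt R`. -/
noncomputable def freeLambda (R : Type) [CommRing R] : (Wt R →₀ ℤ) →+ Tsigma R :=
  Finsupp.liftAddHom fun x =>
    (smulAddHom ℤ (Tsigma R)).flip (clsS R (tmulU R x.2.1.unit x.2.2.unit))

theorem freeLambda_single (R : Type) [CommRing R] (x : Wt R) :
    freeLambda R (Finsupp.single x 1) = clsS R (tmulU R x.2.1.unit x.2.2.unit) := by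
  simp [freeLambda]

theorem pbRel_le_ker_freeLambda (R : Type) [CommRing R] : pbRel R ≤ (freeLambda R).ker := by
  refine (AddSubgroup.closure_le _).2 ?_
  rintro _ ⟨a, b, c, d, e, hab, hc, hd, he, rfl⟩
  rw [SetLike.mem_coe, AddMonoidHom.mem_ker]
  simp only [map_add, map_sub, freeLambda_single]
  simp only [← map_add, ← map_sub]
  rw [tmulU_five_term R a.2.1.unit b.2.1.unit a.2.2.unit b.2.2.unit hab.unit
    c.2.1.unit c.2.2.unit d.2.1.unit d.2.2.unit e.2.1.unit e.2.2.unit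
    rfl rfl rfl hc rfl hd rfl he rfl]
  exact clsS_tmulU_add_swap R _ _

/-- The five-term relation maps under `[a] ↦ a ⊗ (1-a)` to
`a ⊗ ((1-a)(1-b)⁻¹) + ((1-a)(1-b)⁻¹) ⊗ a` in `R^× ⊗_ℤ R^×`; consequently
`λ : 𝔭(R) → (R^× ⊗ R^×)_σ`, `[a] ↦ a ⊗ (1-a)`, is a well-defined homomorphism. -/
theorem stmt11 (R : Type) [CommRing R] (a b : R)
    (ha : IsUnit a) (ha' : IsUnit (1 - a)) (hb : IsUnit b) (hb' : IsUnit (1 - b))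
    (hab : IsUnit (a - b))
    (c c' d d' e e' : Rˣ)
    (hc : (c : R) = b * Ring.inverse a)
    (hc' : (c' : R) = 1 - b * Ring.inverse a)
    (hd : (d : R) = (1 - Ring.inverse a) * Ring.inverse (1 - Ring.inverse b))
    (hd' : (d' : R) = 1 - (1 - Ring.inverse a) * Ring.inverse (1 - Ring.inverse b))
    (he : (e : R) = (1 - a) * Ring.inverse (1 - b))
    (he' : (e' : R) = 1 - (1 - a) * Ring.inverse (1 - b)) :
    (tmulU R ha.unit ha'.unit - tmulU R hb.unit hb'.unit + tmulU R c c'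
        - tmulU R d d' + tmulU R e e'
      = tmulU R ha.unit e + tmulU R e ha.unit) ∧
    ∃ lam : pBloch R →+ Tsigma R,
      ∀ x : Wt R, lam (pcl R x) = clsS R (tmulU R x.2.1.unit x.2.2.unit) := by
  refine ⟨tmulU_five_term R ha.unit hb.unit ha'.unit hb'.unit hab.unit c c' d d' e e'
    rfl rfl rfl hc (hc ▸ hc') hd (hd ▸ hd') he (he ▸ he'), ?_⟩
  exact ⟨QuotientAddGroup.lift (pbRel R) (freeLambda R) (pbRel_le_ker_freeLambda R),
    freeLambda_single R⟩
end

section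
/- Let R be a commutative ring with many units. Then for every unit a ∈ R^× there exists c ∈ R such that c, 1−c and 1−ac are all units of R. -/
/-- In a ring with many units, for every unit `a` there is `c : R`
with `c`, `1 - c` and `1 - a*c` all units. -/
theorem stmt15 (R : Type) [CommRing R] (hR : ManyUnits R) (a : Rˣ) :
    ∃ c : R, IsUnit c ∧ IsUnit (1 - c) ∧ IsUnit (1 - (a : R) * c) := by
  let x : (Fin 2 → R) →ₗ[R] R := LinearMap.proj 0
  let y : (Fin 2 → R) →ₗ[R] R := LinearMap.proj 1
  obtain ⟨v, hv⟩ := hR 2 le_rfl 4 ![x, y, y - x, y - (a : R) • x] (by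
    intro i r
    fin_cases i
    · exact ⟨![r, 0], by simp [x]⟩
    all_goals exact ⟨![0, r], by simp [x, y]⟩)
  have hx : IsUnit (v 0) := by simpa [x] using hv 0
  have hyx : IsUnit (v 1 - v 0) := by simpa [x, y] using hv 2
  have hyax : IsUnit (v 1 - (a : R) * v 0) := by simpa [x, y] using hv 3
  obtain ⟨u, hu⟩ : IsUnit (v 1) := by simpa [y] using hv 1
  have hu_inv : v 1 * (↑u⁻¹ : R) = 1 := by rw [← hu, Units.mul_inv]
  refine ⟨v 0 * ↑u⁻¹, hx.mul u⁻¹.isUnit, ?_, ?_⟩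
  · rw [← hu_inv, ← sub_mul]
    exact hyx.mul u⁻¹.isUnit
  · rw [← hu_inv, ← mul_assoc, ← sub_mul]
    exact hyax.mul u⁻¹.isUnit
end

section
/- Let R be a commutative ring with many units. Then λ restricts to a map B'(R) → ker(α) and induces an isomorphism B'(R)/B(R) ≅ ker(α), where α : (R^× ⊗ R^×)_σ → (R^× ⊗ R^×)_σ̄ is the canonical map. -/
theorem clsS_tmulU_symm (R : Type) [CommRing R] (a b : Rˣ) :
    clsS R (tmulU R a b) + clsS R (tmulU R b a) = 0 := by
  rw [← map_add]
  exact (QuotientAddGroup.eq_zero_iff _).2 (AddSubgroup.subset_closure ⟨a, b, rfl⟩)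

theorem clsS_tmulU_neg_mul (R : Type) [CommRing R] (a b : Rˣ) :
    clsS R (tmulU R (a * b) (-(a * b))) =
      clsS R (tmulU R a (-a)) + clsS R (tmulU R b (-b)) := by
  have h : tmulU R (a * b) (-(a * b)) =
      (tmulU R a (-a) + tmulU R b (-b)) + (tmulU R a b + tmulU R b a) := by
    have h₁ : -(a * b) = -a * b := by simp
    have h₂ : -(a * b) = a * -b := by simp
    rw [tmulU_mul_left, h₁, tmulU_mul_right, ← h₁, h₂, tmulU_mul_right]
    abel
  rw [h, map_add, map_add, map_add, clsS_tmulU_symm, add_zero]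

/-- The identity `a ⊗ (-a) = a ⊗ (1 - a) + a⁻¹ ⊗ (1 - a⁻¹)`. -/
theorem tmulU_neg_eq (R : Type) [CommRing R] (a b c : Rˣ) (hb : (b : R) = 1 - a)
    (hc : (c : R) = 1 - (a⁻¹ : Rˣ)) :
    tmulU R a (-a) = tmulU R a b + tmulU R a⁻¹ c := by
  have h : b = -a * c := by
    ext
    simp [hb, hc, mul_sub]
  rw [h, tmulU_mul_right, tmulU_inv_left]
  abel

theorem clsS_tmulU_neg_mem_range_of_isUnit (R : Type) [CommRing R] (lam : pBloch R →+ Tsigma R)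
    (hlam : ∀ x : Wt R, lam (pcl R x) = clsS R (tmulU R x.2.1.unit x.2.2.unit))
    (a : Rˣ) (ha : IsUnit (1 - (a : R))) :
    clsS R (tmulU R a (-a)) ∈ lam.range := by
  have hinv : IsUnit (1 - ((a⁻¹ : Rˣ) : R)) := by
    have h : 1 - ((a⁻¹ : Rˣ) : R) = ((-a⁻¹ : Rˣ) : R) * (1 - a) := by
      simp [mul_sub]
      ring
    rw [h]
    exact (Units.isUnit _).mul ha
  have hmem (u : Rˣ) (hu : IsUnit (1 - (u : R))) : clsS R (tmulU R u hu.unit) ∈ lam.range :=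
    ⟨pcl R ⟨u, u.isUnit, hu⟩, by rw [hlam, IsUnit.unit_of_val_units]⟩
  rw [tmulU_neg_eq R a ha.unit hinv.unit ha.unit_spec hinv.unit_spec, map_add]
  exact add_mem (hmem a ha) (hmem a⁻¹ hinv)

theorem ManyUnits.exists_unit {R : Type} [CommRing R] (hR : ManyUnits R) (a : Rˣ) :
    ∃ u : Rˣ, IsUnit (1 - (u : R)) ∧ IsUnit (1 - ((a * u : Rˣ) : R)) := by
  let p (i : Fin 2) : (Fin 2 → R) →ₗ[R] R := LinearMap.proj i
  obtain ⟨v, hv⟩ := hR 2 le_rfl 4 ![p 0, p 1, p 1 - p 0, p 1 - (a : R) • p 0] (by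
    intro i r
    fin_cases i
    · exact ⟨![r, 0], by simp [p]⟩
    · exact ⟨![0, r], by simp [p]⟩
    · exact ⟨![0, r], by simp [p]⟩
    · exact ⟨![0, r], by simp [p]⟩)
  obtain ⟨x, hx⟩ : IsUnit (v 0) := hv 0
  obtain ⟨y, hy⟩ : IsUnit (v 1) := hv 1
  have h₁ : IsUnit ((y : R) - x) := by simpa [p, hx, hy] using hv 2
  have h₂ : IsUnit ((y : R) - a * x) := by simpa [p, hx, hy] using hv 3
  refine ⟨y⁻¹ * x, ?_, ?_⟩
  · convert (y⁻¹).isUnit.mul h₁ using 1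
    simp [mul_sub]
  · convert (y⁻¹).isUnit.mul h₂ using 1
    simp [mul_sub, mul_left_comm]

theorem ManyUnits.clsS_tmulU_neg_mem_range {R : Type} [CommRing R] (hR : ManyUnits R)
    (lam : pBloch R →+ Tsigma R)
    (hlam : ∀ x : Wt R, lam (pcl R x) = clsS R (tmulU R x.2.1.unit x.2.2.unit)) (a : Rˣ) :
    clsS R (tmulU R a (-a)) ∈ lam.range := by
  obtain ⟨u, hu, hau⟩ := hR.exists_unit a
  rw [eq_sub_of_add_eq (clsS_tmulU_neg_mul R a u).symm]
  exact sub_mem (clsS_tmulU_neg_mem_range_of_isUnit R lam hlam _ hau)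
    (clsS_tmulU_neg_mem_range_of_isUnit R lam hlam _ hu)

theorem pBloch_hom_ext {R A : Type} [CommRing R] [AddCommGroup A] {f g : pBloch R →+ A}
    (h : ∀ x : Wt R, f (pcl R x) = g (pcl R x)) : f = g := by
  apply QuotientAddGroup.addMonoidHom_ext
  ext x
  exact h x

/-- For a ring with many units, `λ` restricts to a map
`B'(R) → ker α` and induces an isomorphism `B'(R)/B(R) ≅ ker α`, where
`B(R) = ker λ`, `B'(R) = ker η` and `α : (R^× ⊗ R^×)_σ → (R^× ⊗ R^×)_σ̄` is the
canonical map. -/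
theorem stmt17 (R : Type) [CommRing R] (hR : ManyUnits R)
    (lam : pBloch R →+ Tsigma R)
    (hlam : ∀ x : Wt R, lam (pcl R x) = clsS R (tmulU R x.2.1.unit x.2.2.unit))
    (eta : pBloch R →+ Tsigmabar R)
    (heta : ∀ x : Wt R, eta (pcl R x) = clsSb R (tmulU R x.2.1.unit x.2.2.unit))
    (alpha : Tsigma R →+ Tsigmabar R)
    (halpha : ∀ x : TT R, alpha (clsS R x) = clsSb R x) :
    (∀ x ∈ eta.ker, lam x ∈ alpha.ker) ∧
    ∃ e : (eta.ker ⧸ (lam.ker.addSubgroupOf eta.ker)) ≃+ alpha.ker,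
      ∀ x : eta.ker, ((e (QuotientAddGroup.mk x) : alpha.ker) : Tsigma R) = lam x := by
  have hcomp : ∀ x, alpha (lam x) = eta x := DFunLike.congr_fun <|
    pBloch_hom_ext (f := alpha.comp lam) fun x => by simp [hlam, heta, halpha]
  have hmaps : ∀ x ∈ eta.ker, lam x ∈ alpha.ker := fun x hx => by
    rw [AddMonoidHom.mem_ker, hcomp]
    exact hx
  have hrange : ∀ t ∈ sbarSub R, clsS R t ∈ lam.range := by
    have hle : sbarSub R ≤ lam.range.comap (clsS R) := by
      refine (AddSubgroup.closure_le _).2 ?_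
      rintro _ ⟨a, rfl⟩
      exact hR.clsS_tmulU_neg_mem_range lam hlam a
    exact fun t ht => hle ht
  let f : eta.ker →+ alpha.ker :=
    (lam.comp eta.ker.subtype).codRestrict alpha.ker fun x => hmaps x x.2
  have hf : Function.Surjective f := by
    rintro ⟨y, hy⟩
    obtain ⟨t, rfl⟩ := QuotientAddGroup.mk'_surjective _ y
    have ht : clsSb R t = 0 := (halpha t).symm.trans hy
    obtain ⟨z, hz⟩ := hrange t ((QuotientAddGroup.eq_zero_iff _).1 ht)
    refine ⟨⟨z, ?_⟩, Subtype.ext hz⟩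
    rw [AddMonoidHom.mem_ker, ← hcomp, hz]
    exact hy
  have hker : lam.ker.addSubgroupOf eta.ker = f.ker := by
    ext x
    exact (Subtype.ext_iff (a1 := f x) (a2 := 0)).symm
  exact ⟨hmaps, (QuotientAddGroup.quotientAddEquivOfEq hker).trans
    (QuotientAddGroup.quotientKerEquivOfSurjective f hf), fun x => rfl⟩
end
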